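/- Let X be a separable real Hilbert space, Y a real Hilbert space, M ⊆ X nonempty, and F : M → Y continuous and weakly sequentially closed. Let a₀ ∈ X and I₁ ∈ Y, and assume a† ∈ M is the unique a₀-minimum-norm solution of F(a) = I₁ (i.e., a† is an a₀-MNS and every a₀-MNS equals a†). Let (δₖ) and (αₖ) be sequences of positive reals with δₖ → 0, αₖ → 0, and δₖ²/αₖ → 0 as k → ∞; let I₁^{δₖ} ∈ Y satisfy ‖I₁ − I₁^{δₖ}‖_Y ≤ δₖ; and let aₖ ∈ M minimize a ↦ ‖F(a) − I₁^{δₖ}‖_Y² + αₖ‖a − a₀‖_X² over M. Then aₖ → a† in the norm of X as k → ∞. -/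

import Mathlib

open Filter Topology RealInnerProductSpace

/-- A bounded sequence in a separable real Hilbert space has a weakly convergent subsequence. -/
theorem exists_subseq_tendsto_inner_of_norm_le {E : Type*}
    [NormedAddCommGroup E] [InnerProductSpace ℝ E] [CompleteSpace E]
    [TopologicalSpace.SeparableSpace E] {u : ℕ → E} {C : ℝ} (hu : ∀ n, ‖u n‖ ≤ C) :
    ∃ (x : E) (φ : ℕ → ℕ), StrictMono φ ∧
      ∀ z : E, Tendsto (fun n => ⟪u (φ n), z⟫) atTop (𝓝 ⟪x, z⟫) := by
  have hmem : ∀ n, StrongDual.toWeakDual (InnerProductSpace.toDual ℝ E (u n)) ∈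
      WeakDual.toStrongDual ⁻¹' Metric.closedBall (0 : StrongDual ℝ E) C := fun n => by
    simpa using hu n
  obtain ⟨f, -, φ, hφ, hf⟩ := WeakDual.isSeqCompact_closedBall ℝ E 0 C hmem
  refine ⟨(InnerProductSpace.toDual ℝ E).symm (WeakDual.toStrongDual f), φ, hφ, fun z => ?_⟩
  rw [InnerProductSpace.toDual_symm_apply]
  exact ((WeakDual.eval_continuous z).tendsto f).comp hf

section WeakConvergence

variable {E : Type*} [NormedAddCommGroup E] [InnerProductSpace ℝ E]
  {u : ℕ → E} {x : E} {c : ℕ → ℝ} {C : ℝ}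

/-- Weak sequential lower semicontinuity of the squared norm. -/
theorem norm_sq_le_of_tendsto_inner
    (hu : ∀ z : E, Tendsto (fun n => ⟪u n, z⟫) atTop (𝓝 ⟪x, z⟫))
    (hc : Tendsto c atTop (𝓝 C)) (huc : ∀ n, ‖u n‖ ^ 2 ≤ c n) : ‖x‖ ^ 2 ≤ C := by
  have h := le_of_tendsto_of_tendsto' (((hu x).const_mul 2).sub_const (‖x‖ ^ 2)) hc fun n => by
    have := norm_sub_sq_real (u n) x
    linarith [sq_nonneg ‖u n - x‖, huc n]
  rw [real_inner_self_eq_norm_sq] at h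
  linarith

/-- The Radon–Riesz property: weak convergence without loss of norm is strong convergence. -/
theorem tendsto_of_tendsto_inner_of_norm_sq_le
    (hu : ∀ z : E, Tendsto (fun n => ⟪u n, z⟫) atTop (𝓝 ⟪x, z⟫))
    (hc : Tendsto c atTop (𝓝 (‖x‖ ^ 2))) (huc : ∀ n, ‖u n‖ ^ 2 ≤ c n) :
    Tendsto u atTop (𝓝 x) := by
  have hlim : Tendsto (fun n => c n - 2 * ⟪u n, x⟫ + ‖x‖ ^ 2) atTop (𝓝 0) := by
    have h := (hc.sub ((hu x).const_mul 2)).add_const (‖x‖ ^ 2)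
    rw [real_inner_self_eq_norm_sq] at h
    convert h using 2
    ring
  have hsq : Tendsto (fun n => ‖u n - x‖ ^ 2) atTop (𝓝 0) :=
    squeeze_zero (fun n => sq_nonneg _)
      (fun n => by linarith [norm_sub_sq_real (u n) x, huc n]) hlim
  rw [tendsto_iff_norm_sub_tendsto_zero]
  simpa [Real.sqrt_sq (norm_nonneg _)] using hsq.sqrt

end WeakConvergence

/-- Convergence of Tikhonov regularization (IIM, restricted noise case,
unique minimum-norm solution): under the hypotheses of the convergence theorem, if the
`a₀`-minimum-norm solution `a†` of `F(a) = I₁` is unique, then the whole sequence of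
Tikhonov minimizers converges to `a†` in norm. -/
theorem iim_tikhonov_convergence_restricted_noise_unique
    {X Y : Type*}
    [NormedAddCommGroup X] [InnerProductSpace ℝ X] [CompleteSpace X]
    [TopologicalSpace.SeparableSpace X]
    [NormedAddCommGroup Y] [InnerProductSpace ℝ Y] [CompleteSpace Y]
    (M : Set X) (hM : M.Nonempty)
    (F : X → Y) (hFcont : ContinuousOn F M)
    (hFwsc : ∀ (b : ℕ → X), (∀ n, b n ∈ M) → ∀ (x : X) (y : Y),
      (∀ z : X, Tendsto (fun n => ⟪b n, z⟫) atTop (𝓝 ⟪x, z⟫)) →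
      (∀ z : Y, Tendsto (fun n => ⟪F (b n), z⟫) atTop (𝓝 ⟪y, z⟫)) →
      x ∈ M ∧ F x = y)
    (a₀ : X) (I₁ : Y) (adag : X)
    (hadagMNS : adag ∈ M ∧ F adag = I₁ ∧
      ∀ b ∈ M, F b = I₁ → ‖adag - a₀‖ ≤ ‖b - a₀‖)
    (huniq : ∀ b : X, (b ∈ M ∧ F b = I₁ ∧
      ∀ c ∈ M, F c = I₁ → ‖b - a₀‖ ≤ ‖c - a₀‖) → b = adag)
    (δ α : ℕ → ℝ) (hδpos : ∀ k, 0 < δ k) (hαpos : ∀ k, 0 < α k)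
    (hδ0 : Tendsto δ atTop (𝓝 0)) (hα0 : Tendsto α atTop (𝓝 0))
    (hratio : Tendsto (fun k => (δ k) ^ 2 / α k) atTop (𝓝 0))
    (I₁δ : ℕ → Y) (hnoise : ∀ k, ‖I₁ - I₁δ k‖ ≤ δ k)
    (a : ℕ → X) (hamem : ∀ k, a k ∈ M)
    (hmin : ∀ k, ∀ b ∈ M,
      ‖F (a k) - I₁δ k‖ ^ 2 + α k * ‖a k - a₀‖ ^ 2 ≤
        ‖F b - I₁δ k‖ ^ 2 + α k * ‖b - a₀‖ ^ 2) :
    Tendsto a atTop (𝓝 adag) := by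
  obtain ⟨hadM, hFad, hadmin⟩ := hadagMNS
  set c : ℕ → ℝ := fun k => δ k ^ 2 / α k + ‖adag - a₀‖ ^ 2 with hc_def
  have hbound : ∀ k, ‖F (a k) - I₁δ k‖ ^ 2 + α k * ‖a k - a₀‖ ^ 2 ≤
      δ k ^ 2 + α k * ‖adag - a₀‖ ^ 2 := fun k => by
    have h := hmin k adag hadM
    have h' := pow_le_pow_left₀ (norm_nonneg _) (hnoise k) 2
    rw [hFad] at h
    linarith
  have hac : ∀ k, ‖a k - a₀‖ ^ 2 ≤ c k := fun k => by
    have hα := hαpos k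
    have h : α k * ‖a k - a₀‖ ^ 2 ≤ α k * c k := by
      have hck : α k * c k = δ k ^ 2 + α k * ‖adag - a₀‖ ^ 2 := by
        simp only [hc_def]
        field_simp
      linarith [hbound k, sq_nonneg ‖F (a k) - I₁δ k‖]
    exact le_of_mul_le_mul_left h hα
  have hc : Tendsto c atTop (𝓝 (‖adag - a₀‖ ^ 2)) := by
    simpa using hratio.add_const (‖adag - a₀‖ ^ 2)
  have hF : Tendsto (fun k => F (a k)) atTop (𝓝 I₁) := by
    have hlim : Tendsto (fun k => δ k ^ 2 + α k * ‖adag - a₀‖ ^ 2) atTop (𝓝 0) := by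
      simpa using (hδ0.pow 2).add (hα0.mul_const (‖adag - a₀‖ ^ 2))
    have hsq : Tendsto (fun k => ‖F (a k) - I₁δ k‖ ^ 2) atTop (𝓝 0) :=
      squeeze_zero (fun k => sq_nonneg _) (fun k => by
        linarith [hbound k, mul_nonneg (hαpos k).le (sq_nonneg ‖a k - a₀‖)]) hlim
    have hres : Tendsto (fun k => ‖F (a k) - I₁δ k‖) atTop (𝓝 0) := by
      simpa [Real.sqrt_sq (norm_nonneg _)] using hsq.sqrt
    rw [tendsto_iff_norm_sub_tendsto_zero]
    refine squeeze_zero (fun k => norm_nonneg _) (fun k => ?_) (by simpa using hres.add hδ0)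
    have htri := norm_sub_le_norm_sub_add_norm_sub (F (a k)) (I₁δ k) I₁
    rw [norm_sub_rev (I₁δ k)] at htri
    linarith [hnoise k]
  obtain ⟨B, hB⟩ := hc.bddAbove_range
  have hnorm : ∀ k, ‖a k - a₀‖ ≤ √B := fun k =>
    Real.le_sqrt_of_sq_le ((hac k).trans (hB ⟨k, rfl⟩))
  refine tendsto_of_subseq_tendsto fun ns hns => ?_
  obtain ⟨x, φ, hφ, hx⟩ := exists_subseq_tendsto_inner_of_norm_le fun n => hnorm (ns n)
  refine ⟨φ, ?_⟩
  have hnsφ : Tendsto (fun n => ns (φ n)) atTop atTop := hns.comp hφ.tendsto_atTop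
  have hcφ := hc.comp hnsφ
  have hle : ‖x‖ ≤ ‖adag - a₀‖ :=
    le_of_sq_le_sq (norm_sq_le_of_tendsto_inner hx hcφ fun n => hac _) (norm_nonneg _)
  obtain ⟨hxM, hFx⟩ := hFwsc (fun n => a (ns (φ n))) (fun n => hamem _) (x + a₀) I₁
    (fun z => by simpa [inner_sub_left, inner_add_left] using (hx z).add_const ⟪a₀, z⟫)
    (fun z => (hF.comp hnsφ).inner tendsto_const_nhds)
  have hxad : x + a₀ = adag := huniq _ ⟨hxM, hFx, fun b hb hFb => by
    simpa using hle.trans (hadmin b hb hFb)⟩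
  obtain rfl : x = adag - a₀ := eq_sub_of_add_eq hxad
  simpa using (tendsto_of_tendsto_inner_of_norm_sq_le hx hcφ fun n => hac _).add_const a₀
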